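/- arXiv:1902.00807 — 2 statements merged into one kernel-verified Lean document; each statement's English description precedes it below -/
import Mathlib

section
/- Let A be the set of pairs (v,w) of permutations in S_n such that v ∈ W^K_max and ℓ(w) = ℓ(w v^{-1}) + ℓ(v), and let B be the set of pairs (J,L) of k-element subsets of [n] such that, for every r with 1 ≤ r ≤ k, the r-th smallest element of J is less than or equal to the r-th smallest element of L. Then the map sending (v,w) ∈ A to the pair (x({1,…,k}), {n+1−s : s ∈ v^{-1}({1,…,k})}), where x := w v^{-1}, is a bijection from A onto B. -/
/-- `v` fixes every point outside `{1, …, n}`. -/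
def fixesOutside (n : ℕ) (v : Equiv.Perm ℕ) : Prop :=
  ∀ i, i ∉ Finset.Icc 1 n → v i = i

/-- `v ∈ W^K_max`: `v⁻¹(1) > ⋯ > v⁻¹(k)` and `v⁻¹(k+1) > ⋯ > v⁻¹(n)`. -/
def isWKmax (n k : ℕ) (v : Equiv.Perm ℕ) : Prop :=
  fixesOutside n v ∧
  (∀ i j, 1 ≤ i → i < j → j ≤ k → v.symm j < v.symm i) ∧
  (∀ i j, k + 1 ≤ i → i < j → j ≤ n → v.symm j < v.symm i)

/-- the Coxeter length of `x` as a permutation of `{1,…,n}`: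
the number of inversions `(i,j)` with `1 ≤ i < j ≤ n` and `x(i) > x(j)`. -/
def invLen (n : ℕ) (x : Equiv.Perm ℕ) : ℕ :=
  ((Finset.Icc 1 n ×ˢ Finset.Icc 1 n).filter fun p => p.1 < p.2 ∧ x p.2 < x p.1).card

/-- the `r`-th smallest element of a finite set of naturals (`r` is 1-indexed). -/
def sortedGet (J : Finset ℕ) (r : ℕ) : ℕ :=
  (J.sort (· ≤ ·)).getD (r - 1) 0

/-- `x` is a permutation of `{1,…,n}` that is increasing on `{1,…,k}` and on `{k+1,…,n}`. -/
def isGrassmannian (n k : ℕ) (x : Equiv.Perm ℕ) : Prop :=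
  fixesOutside n x ∧
  StrictMonoOn x (Finset.Icc 1 k) ∧ StrictMonoOn x (Finset.Icc (k + 1) n)

theorem fixesOutside.mem_iff {n : ℕ} {x : Equiv.Perm ℕ} (hx : fixesOutside n x) (i : ℕ) :
    x i ∈ Finset.Icc 1 n ↔ i ∈ Finset.Icc 1 n := by
  constructor
  · intro h
    by_contra h'
    exact h' (hx i h' ▸ h)
  · intro h
    by_contra h'
    have := x.injective (hx _ h')
    rw [this] at h'
    exact h' h

theorem fixesOutside.mul {n : ℕ} {x y : Equiv.Perm ℕ} (hx : fixesOutside n x)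
    (hy : fixesOutside n y) : fixesOutside n (x * y) := fun i hi => by
  rw [Equiv.Perm.mul_apply, hy i hi, hx i hi]

theorem fixesOutside.inv {n : ℕ} {x : Equiv.Perm ℕ} (hx : fixesOutside n x) :
    fixesOutside n x⁻¹ := fun i hi => by
  rw [Equiv.Perm.inv_eq_iff_eq, hx i hi]

theorem fixesOutside.image_Icc {n : ℕ} {x : Equiv.Perm ℕ} (hx : fixesOutside n x) :
    (Finset.Icc 1 n).image x = Finset.Icc 1 n :=
  Finset.eq_of_subset_of_card_le
    (Finset.image_subset_iff.2 fun i hi => (hx.mem_iff i).2 hi)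
    (Finset.card_image_of_injective _ x.injective).ge

/-- The permutation `i ↦ n + 1 - i` of `{1,…,n}`, i.e. the longest element. -/
def revPerm (n : ℕ) : Equiv.Perm ℕ :=
  Function.Involutive.toPerm (fun i => if i ∈ Finset.Icc 1 n then n + 1 - i else i) fun i => by
    simp only [Finset.mem_Icc]
    split_ifs <;> omega

theorem revPerm_of_mem {n i : ℕ} (hi : i ∈ Finset.Icc 1 n) : revPerm n i = n + 1 - i :=
  if_pos hi

theorem fixesOutside_revPerm (n : ℕ) : fixesOutside n (revPerm n) := fun _ hi => if_neg hi

theorem revPerm_mul_self (n : ℕ) : revPerm n * revPerm n = 1 :=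
  Equiv.ext (Function.Involutive.toPerm_involutive _)

theorem revPerm_lt_iff {n i j : ℕ} (hi : i ∈ Finset.Icc 1 n) (hj : j ∈ Finset.Icc 1 n) :
    revPerm n i < revPerm n j ↔ j < i := by
  rw [revPerm_of_mem hi, revPerm_of_mem hj]
  simp only [Finset.mem_Icc] at hi hj
  omega

theorem isWKmax_iff_isGrassmannian {n k : ℕ} (hkn : k < n) (v : Equiv.Perm ℕ) :
    isWKmax n k v ↔ isGrassmannian n k (revPerm n * v⁻¹) := by
  have hfix : fixesOutside n v ↔ fixesOutside n (revPerm n * v⁻¹) := by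
    refine ⟨fun h => (fixesOutside_revPerm n).mul h.inv, fun h => ?_⟩
    have := (h.inv).mul (fixesOutside_revPerm n)
    rwa [mul_inv_rev, inv_inv, inv_eq_of_mul_eq_one_left (revPerm_mul_self n), mul_assoc,
      revPerm_mul_self, mul_one] at this
  unfold isWKmax isGrassmannian
  rw [← hfix]
  refine and_congr_right fun hv => ?_
  have key : ∀ i j, i ∈ Finset.Icc 1 n → j ∈ Finset.Icc 1 n →
      ((revPerm n * v⁻¹) i < (revPerm n * v⁻¹) j ↔ v.symm j < v.symm i) := fun i j hi hj =>
    revPerm_lt_iff ((hv.inv.mem_iff i).2 hi) ((hv.inv.mem_iff j).2 hj)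
  simp only [Finset.mem_Icc] at key
  refine and_congr ⟨fun h i hi j hj hij => ?_, fun h i j hi hij hj => ?_⟩
    ⟨fun h i hi j hj hij => ?_, fun h i j hi hij hj => ?_⟩
  · simp only [Finset.coe_Icc, Set.mem_Icc] at hi hj
    exact (key i j (by omega) (by omega)).2 (h i j (by omega) hij (by omega))
  · exact (key i j (by omega) (by omega)).1
      (h (by simp; omega) (by simp; omega) hij)
  · simp only [Finset.coe_Icc, Set.mem_Icc] at hi hj
    exact (key i j (by omega) (by omega)).2 (h i j (by omega) hij (by omega))
  · exact (key i j (by omega) (by omega)).1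
      (h (by simp; omega) (by simp; omega) hij)

theorem invLen_mul_add {n : ℕ} (x : Equiv.Perm ℕ) {v : Equiv.Perm ℕ} (hv : fixesOutside n v) :
    invLen n (x * v) + 2 * ((Finset.Icc 1 n ×ˢ Finset.Icc 1 n).filter fun p =>
      p.1 < p.2 ∧ v p.2 < v p.1 ∧ x (v p.1) < x (v p.2)).card = invLen n x + invLen n v := by
  set P := Finset.Icc 1 n ×ˢ Finset.Icc 1 n with hP
  set A := (P.filter fun p => p.1 < p.2 ∧ v p.1 < v p.2 ∧ x (v p.2) < x (v p.1)) with hA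
  set B := (P.filter fun p => p.1 < p.2 ∧ v p.2 < v p.1 ∧ x (v p.1) < x (v p.2)) with hB
  set B' := (P.filter fun p => p.2 < p.1 ∧ v p.1 < v p.2 ∧ x (v p.2) < x (v p.1)) with hB'
  set C := (P.filter fun p => p.1 < p.2 ∧ v p.2 < v p.1 ∧ x (v p.2) < x (v p.1)) with hC
  have hvv : ∀ i, v (v⁻¹ i) = i := v.apply_symm_apply
  have ne : ∀ p : ℕ × ℕ, p.1 < p.2 → v p.1 ≠ v p.2 := fun p h h' => h.ne (v.injective h')
  have nex : ∀ p : ℕ × ℕ, p.1 < p.2 → x (v p.1) ≠ x (v p.2) :=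
    fun p h h' => ne p h (x.injective h')
  have h1 : invLen n (x * v) = A.card + C.card := by
    rw [← Finset.card_union_of_disjoint]
    · unfold invLen
      congr 1
      ext p
      have := ne p
      simp only [hA, hC, ← hP, Finset.mem_filter, Finset.mem_union, Equiv.Perm.mul_apply]
      grind
    · rw [Finset.disjoint_left]
      grind
  have h2 : invLen n v = B.card + C.card := by
    rw [← Finset.card_union_of_disjoint]
    · unfold invLen
      congr 1
      ext p
      have := nex p
      simp only [hB, hC, ← hP, Finset.mem_filter, Finset.mem_union]
      grind
    · rw [Finset.disjoint_left]
      grind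
  have h3 : B'.card = B.card := by
    refine Finset.card_bij' (fun p _ => p.swap) (fun p _ => p.swap) ?_ ?_ ?_ ?_
    · rintro ⟨i, j⟩ h
      simp only [hB, hB', hP, Finset.mem_filter, Finset.mem_product, Prod.swap] at h ⊢
      tauto
    · rintro ⟨i, j⟩ h
      simp only [hB, hB', hP, Finset.mem_filter, Finset.mem_product, Prod.swap] at h ⊢
      tauto
    · simp
    · simp
  have h4 : invLen n x = A.card + B'.card := by
    rw [← Finset.card_union_of_disjoint]
    · unfold invLen
      symm
      refine Finset.card_bij' (fun p _ => (v p.1, v p.2)) (fun p _ => (v⁻¹ p.1, v⁻¹ p.2)) ?_ ?_ ?_ ?_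
      · rintro ⟨i, j⟩ h
        simp only [hA, hB', hP, Finset.mem_filter, Finset.mem_union, Finset.mem_product,
          hv.mem_iff] at h ⊢
        tauto
      · rintro ⟨i, j⟩ h
        have hij : v⁻¹ i ≠ v⁻¹ j := fun e => by
          have := v⁻¹.injective e
          simp only [Finset.mem_filter] at h
          omega
        simp only [hA, hB', hP, Finset.mem_filter, Finset.mem_union, Finset.mem_product,
          hv.inv.mem_iff, hvv] at h ⊢
        rcases lt_or_gt_of_ne hij <;> tauto
      · simp
      · simp
    · rw [Finset.disjoint_left]
      grind
  omega

theorem invLen_mul_eq_add_iff {n : ℕ} (x : Equiv.Perm ℕ) {v : Equiv.Perm ℕ}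
    (hv : fixesOutside n v) :
    invLen n (x * v) = invLen n x + invLen n v ↔
      ∀ a ∈ Finset.Icc 1 n, ∀ b ∈ Finset.Icc 1 n, a < b → v⁻¹ b < v⁻¹ a → x a < x b := by
  rw [← invLen_mul_add x hv, left_eq_add, mul_eq_zero, or_iff_right two_ne_zero,
    Finset.card_eq_zero, Finset.filter_eq_empty_iff]
  constructor
  · intro h a ha b hb hab hvab
    by_contra hx
    have hne : x a ≠ x b := fun e => hab.ne (x.injective e)
    refine @h (v⁻¹ b, v⁻¹ a) ?_ ?_
    · exact Finset.mem_product.2 ⟨(hv.inv.mem_iff b).2 hb, (hv.inv.mem_iff a).2 ha⟩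
    · have hvv : ∀ i, v (v⁻¹ i) = i := v.apply_symm_apply
      simp only [hvv]
      omega
  · rintro h ⟨i, j⟩ hp ⟨hij, hvij, hx⟩
    rw [Finset.mem_product] at hp
    have := h (v j) ((hv.mem_iff j).2 hp.2) (v i) ((hv.mem_iff i).2 hp.1) hvij (by simpa using hij)
    exact lt_asymm this hx

theorem fixesOutside.card_filter_lt {n : ℕ} {x : Equiv.Perm ℕ} (hx : fixesOutside n x) {m : ℕ}
    (hm : m ≤ n + 1) : ((Finset.Icc 1 n).filter fun c => x c < m).card = m - 1 := by
  rw [← Finset.card_image_of_injective _ x.injective, ← Finset.filter_image (p := (· < m)), hx.image_Icc]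
  trans (Finset.Icc 1 (m - 1)).card
  · congr 1
    ext i
    simp only [Finset.mem_filter, Finset.mem_Icc]
    omega
  · simp

theorem isGrassmannian.lt_iff {n k : ℕ} {x : Equiv.Perm ℕ} (hx : isGrassmannian n k x) {a b : ℕ}
    (ha : 1 ≤ a) (hak : a ≤ k) (hkb : k < b) (hbn : b ≤ n) : x a < x b ↔ x a + k < a + b := by
  obtain ⟨hfix, h1, h2⟩ := hx
  have hxa := (hfix.mem_iff a).2 (by simp; omega)
  rw [Finset.mem_Icc] at hxa
  have hcard := hfix.card_filter_lt (m := x a) (by omega)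
  have hdisj : ∀ c, Disjoint (Finset.Icc 1 (a - 1)) (Finset.Icc (k + 1) c) := fun c => by
    rw [Finset.disjoint_left]
    intro i
    simp only [Finset.mem_Icc]
    omega
  constructor
  · intro h
    have hsub : ((Finset.Icc 1 n).filter fun c => x c < x a) ⊆
        Finset.Icc 1 (a - 1) ∪ Finset.Icc (k + 1) (b - 1) := by
      intro c hc
      simp only [Finset.mem_filter, Finset.mem_Icc, Finset.mem_union] at hc ⊢
      by_cases hck : c ≤ k
      · have := (h1.lt_iff_lt (a := c) (b := a) (by simp; omega) (by simp; omega)).1 hc.2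
        omega
      · have := (h2.lt_iff_lt (a := c) (b := b) (by simp; omega) (by simp; omega)).1
          (hc.2.trans h)
        omega
    have := Finset.card_le_card hsub
    rw [Finset.card_union_of_disjoint (hdisj _), hcard] at this
    simp only [Nat.card_Icc] at this
    omega
  · intro h
    by_contra hlt
    have hne : x a ≠ x b := fun e => by
      have := x.injective e
      omega
    have hsub : Finset.Icc 1 (a - 1) ∪ Finset.Icc (k + 1) b ⊆
        ((Finset.Icc 1 n).filter fun c => x c < x a) := by
      intro c hc
      simp only [Finset.mem_filter, Finset.mem_Icc, Finset.mem_union] at hc ⊢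
      refine ⟨by omega, ?_⟩
      rcases hc with hc | hc
      · exact h1 (by simp; omega) (by simp; omega) (by omega)
      · have := (h2.le_iff_le (a := c) (b := b) (by simp; omega) (by simp; omega)).2 hc.2
        omega
    have := Finset.card_le_card hsub
    rw [Finset.card_union_of_disjoint (hdisj _), hcard] at this
    simp only [Nat.card_Icc] at this
    omega

theorem sortedGet_image_Icc {f : ℕ → ℕ} {m l r : ℕ}
    (hf : StrictMonoOn f (Finset.Icc (m + 1) (m + l))) (hr : 1 ≤ r) (hrl : r ≤ l) :
    sortedGet ((Finset.Icc (m + 1) (m + l)).image f) r = f (m + r) := by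
  have hsorted : ((List.range' (m + 1) l).map f).Pairwise (· < ·) := by
    rw [List.pairwise_map]
    refine (List.pairwise_lt_range' (s := m + 1) (n := l)).imp_of_mem ?_
    intro i j hi hj hij
    rw [List.mem_range'_1] at hi hj
    exact hf (by simp; omega) (by simp; omega) hij
  have hsort : ((Finset.Icc (m + 1) (m + l)).image f).sort (· ≤ ·) =
      (List.range' (m + 1) l).map f := by
    have himg : (Finset.Icc (m + 1) (m + l)).image f =
        ((List.range' (m + 1) l).map f).toFinset := by
      ext i
      simp only [Finset.mem_image, Finset.mem_Icc, List.mem_toFinset, List.mem_map,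
        List.mem_range'_1]
      refine exists_congr fun c => and_congr_left fun _ => ?_
      omega
    rw [himg]
    exact (List.toFinset_sort _ (hsorted.imp ne_of_lt)).2 (hsorted.imp le_of_lt)
  rw [sortedGet, hsort, List.getD_eq_getElem _ _ (by simp; omega)]
  simp only [List.getElem_map, List.getElem_range']
  congr 1
  omega

theorem sortedGet_mem {J : Finset ℕ} {r : ℕ} (hr : 1 ≤ r) (hrJ : r ≤ J.card) :
    sortedGet J r ∈ J := by
  rw [sortedGet, List.getD_eq_getElem _ _ (by simp; omega), ← Finset.mem_sort (· ≤ ·)]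
  exact List.getElem_mem _

theorem sortedGet_lt {J : Finset ℕ} {r s : ℕ} (hr : 1 ≤ r) (hrs : r < s) (hsJ : s ≤ J.card) :
    sortedGet J r < sortedGet J s := by
  rw [sortedGet, sortedGet, List.getD_eq_getElem _ _ (by simp; omega),
    List.getD_eq_getElem _ _ (by simp; omega)]
  exact (Finset.sortedLT_sort J).getElem_lt_getElem_of_lt (by omega)

theorem isGrassmannian.sortedGet_image {n k : ℕ} {x : Equiv.Perm ℕ} (hx : isGrassmannian n k x)
    {r : ℕ} (hr : 1 ≤ r) (hrk : r ≤ k) : sortedGet ((Finset.Icc 1 k).image x) r = x r := by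
  have := sortedGet_image_Icc (f := x) (m := 0) (l := k) (by simpa using hx.2.1) hr hrk
  simpa using this

theorem fixesOutside.image_Icc_succ {n k : ℕ} {x : Equiv.Perm ℕ} (hx : fixesOutside n x) :
    (Finset.Icc (k + 1) n).image x =
      Finset.Icc 1 n \ (Finset.Icc 1 k).image x := by
  conv_rhs => rw [← hx.image_Icc]
  rw [← Finset.image_sdiff _ _ x.injective]
  congr 1
  ext i
  simp only [Finset.mem_sdiff, Finset.mem_Icc]
  omega

theorem isGrassmannian.eq_of_image_eq {n k : ℕ} (hkn : k ≤ n) {x y : Equiv.Perm ℕ}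
    (hx : isGrassmannian n k x) (hy : isGrassmannian n k y)
    (h : (Finset.Icc 1 k).image x = (Finset.Icc 1 k).image y) : x = y := by
  ext i
  by_cases hi : i ∈ Finset.Icc 1 n
  · rw [Finset.mem_Icc] at hi
    by_cases hik : i ≤ k
    · rw [← hx.sortedGet_image hi.1 hik, h, hy.sortedGet_image hi.1 hik]
    · have key : ∀ z, isGrassmannian n k z →
          sortedGet ((Finset.Icc (k + 1) n).image z) (i - k) = z i := fun z hz => by
        have := sortedGet_image_Icc (f := z) (m := k) (l := n - k) (r := i - k)
          (by simpa [Nat.add_sub_cancel' hkn] using hz.2.2) (by omega) (by omega)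
        rwa [Nat.add_sub_cancel' hkn, Nat.add_sub_cancel' (by omega)] at this
      rw [← key x hx, ← key y hy, hx.1.image_Icc_succ, hy.1.image_Icc_succ, h]
  · rw [hx.1 i hi, hy.1 i hi]

theorem exists_isGrassmannian {n : ℕ} {J : Finset ℕ} (hJ : J ⊆ Finset.Icc 1 n) :
    ∃ x, isGrassmannian n J.card x ∧ (Finset.Icc 1 J.card).image x = J := by
  set k := J.card with hk
  set J' := Finset.Icc 1 n \ J with hJ'
  have hcard : J'.card = n - k := by
    rw [hJ', Finset.card_sdiff_of_subset hJ, Nat.card_Icc, Nat.add_sub_cancel]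
  have hkn : k ≤ n := by simpa using Finset.card_le_card hJ
  let f : ℕ → ℕ := fun i =>
    if i ∈ Finset.Icc 1 n then if i ≤ k then sortedGet J i else sortedGet J' (i - k) else i
  have hf0 : ∀ i, i ∉ Finset.Icc 1 n → f i = i := fun i hi => if_neg hi
  have hf1 : ∀ i, 1 ≤ i → i ≤ k → f i = sortedGet J i := fun i h h' => by
    simp only [f, Finset.mem_Icc]
    rw [if_pos (by omega), if_pos h']
  have hf2 : ∀ i, k + 1 ≤ i → i ≤ n → f i = sortedGet J' (i - k) := fun i h h' => by
    simp only [f, Finset.mem_Icc]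
    rw [if_pos (by omega), if_neg (by omega)]
  have hm1 : ∀ i, 1 ≤ i → i ≤ k → f i ∈ J := fun i h h' => by
    rw [hf1 i h h']
    exact sortedGet_mem h (by omega)
  have hm2 : ∀ i, k + 1 ≤ i → i ≤ n → f i ∈ J' := fun i h h' => by
    rw [hf2 i h h']
    exact sortedGet_mem (by omega) (by omega)
  have hs1 : StrictMonoOn f (Finset.Icc 1 k) := by
    intro i hi j hj hij
    simp only [Finset.coe_Icc, Set.mem_Icc] at hi hj
    rw [hf1 i hi.1 hi.2, hf1 j hj.1 hj.2]
    exact sortedGet_lt hi.1 hij hj.2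
  have hs2 : StrictMonoOn f (Finset.Icc (k + 1) n) := by
    intro i hi j hj hij
    simp only [Finset.coe_Icc, Set.mem_Icc] at hi hj
    rw [hf2 i hi.1 hi.2, hf2 j hj.1 hj.2]
    exact sortedGet_lt (by omega) (by omega) (by omega)
  have hmaps : ∀ i ∈ Finset.Icc 1 n, f i ∈ Finset.Icc 1 n := fun i hi => by
    rw [Finset.mem_Icc] at hi
    by_cases hik : i ≤ k
    · exact hJ (hm1 i hi.1 hik)
    · exact (Finset.mem_sdiff.1 (hm2 i (by omega) hi.2)).1
  have hinj : Set.InjOn f (Finset.Icc 1 n) := by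
    intro i hi j hj hij
    simp only [Finset.coe_Icc, Set.mem_Icc] at hi hj
    by_cases hik : i ≤ k <;> by_cases hjk : j ≤ k
    · exact hs1.injOn (by simp; omega) (by simp; omega) hij
    · exact absurd (hij ▸ hm1 i hi.1 hik) (Finset.mem_sdiff.1 (hm2 j (by omega) hj.2)).2
    · exact absurd (hij ▸ hm1 j hj.1 hjk) (Finset.mem_sdiff.1 (hm2 i (by omega) hi.2)).2
    · exact hs2.injOn (by simp; omega) (by simp; omega) hij
  have himg : (Finset.Icc 1 n).image f = Finset.Icc 1 n :=
    Finset.eq_of_subset_of_card_le (Finset.image_subset_iff.2 hmaps)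
      (Finset.card_image_of_injOn hinj).ge
  have hbij : Function.Bijective f := by
    refine ⟨fun i j hij => ?_, fun j => ?_⟩
    · by_cases hi : i ∈ Finset.Icc 1 n <;> by_cases hj : j ∈ Finset.Icc 1 n
      · exact hinj hi hj hij
      · exact absurd (hf0 j hj ▸ hij ▸ hmaps i hi) hj
      · exact absurd (hf0 i hi ▸ hij ▸ hmaps j hj) hi
      · rwa [hf0 i hi, hf0 j hj] at hij
    · by_cases hj : j ∈ Finset.Icc 1 n
      · rw [← himg, Finset.mem_image] at hj
        exact ⟨hj.choose, hj.choose_spec.2⟩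
      · exact ⟨j, hf0 j hj⟩
  refine ⟨Equiv.ofBijective f hbij, ⟨hf0, hs1, hs2⟩, ?_⟩
  refine Finset.eq_of_subset_of_card_le (Finset.image_subset_iff.2 fun i hi => ?_) ?_
  · rw [Finset.mem_Icc] at hi
    exact hm1 i hi.1 hi.2
  · rw [Finset.card_image_of_injective _ (Equiv.injective _)]
    simp [← hk]

theorem isGrassmannian.forall_le_iff {n k : ℕ} {x u : Equiv.Perm ℕ} (hkn : k ≤ n)
    (hx : isGrassmannian n k x) (hu : isGrassmannian n k u) :
    (∀ a b, 1 ≤ a → a ≤ k → k < b → b ≤ n → u a < u b → x a < x b) ↔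
      ∀ a, 1 ≤ a → a ≤ k → x a ≤ u a := by
  constructor
  · intro h a ha hak
    by_contra hlt
    have hxa := (hx.1.mem_iff a).2 (by simp; omega)
    rw [Finset.mem_Icc] at hxa
    have hua : a ≤ u a := by
      by_contra hlt'
      have hsub : (Finset.Icc 1 a).image u ⊆ Finset.Icc 1 (a - 1) := by
        refine Finset.image_subset_iff.2 fun i hi => ?_
        have hi' := Finset.mem_Icc.1 hi
        have h1 := Finset.mem_Icc.1 ((hu.1.mem_iff i).2 (by simp; omega))
        have := (hu.2.1.le_iff_le (a := i) (b := a) (by simp; omega) (by simp; omega)).2 hi'.2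
        simp only [Finset.mem_Icc]
        omega
      have := Finset.card_le_card hsub
      rw [Finset.card_image_of_injective _ u.injective] at this
      simp only [Nat.card_Icc] at this
      omega
    have hxan : x a + k ≤ n + a := by
      by_contra hlt'
      have hsub : (Finset.Icc a k).image x ⊆ Finset.Icc (x a) n := by
        refine Finset.image_subset_iff.2 fun i hi => ?_
        have hi' := Finset.mem_Icc.1 hi
        have h1 := Finset.mem_Icc.1 ((hx.1.mem_iff i).2 (by simp; omega))
        have := (hx.2.1.le_iff_le (a := a) (b := i) (by simp; omega) (by simp; omega)).2 hi'.1
        simp only [Finset.mem_Icc]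
        omega
      have := Finset.card_le_card hsub
      rw [Finset.card_image_of_injective _ x.injective] at this
      simp only [Nat.card_Icc] at this
      omega
    have h1 := (hu.lt_iff (b := u a + k + 1 - a) ha hak (by omega) (by omega)).2 (by omega)
    have h2 := h a _ ha hak (by omega) (by omega) h1
    rw [hx.lt_iff ha hak (by omega) (by omega)] at h2
    omega
  · intro h a b ha hak hkb hbn
    rw [hx.lt_iff ha hak hkb hbn, hu.lt_iff ha hak hkb hbn]
    have := h a ha hak
    omega

/-- If `v ∈ W^K_max`, then `x v` is a length-additive product exactly when `x` is Grassmannian and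
its first `k` values are dominated by those of the reversal of `v⁻¹`. -/
theorem isWKmax.invLen_mul_eq_add_iff {n k : ℕ} (hkn : k < n) {x v : Equiv.Perm ℕ}
    (hx : fixesOutside n x) (hv : isWKmax n k v) :
    invLen n (x * v) = invLen n x + invLen n v ↔
      isGrassmannian n k x ∧ ∀ a, 1 ≤ a → a ≤ k → x a ≤ (revPerm n * v⁻¹) a := by
  have hu := (isWKmax_iff_isGrassmannian hkn v).1 hv
  set u := revPerm n * v⁻¹ with hudef
  have hlt : ∀ a ∈ Finset.Icc 1 n, ∀ b ∈ Finset.Icc 1 n, (v⁻¹ b < v⁻¹ a ↔ u a < u b) :=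
    fun a ha b hb =>
      (revPerm_lt_iff ((hv.1.inv.mem_iff a).2 ha) ((hv.1.inv.mem_iff b).2 hb)).symm
  rw [_root_.invLen_mul_eq_add_iff x hv.1]
  simp only [Finset.mem_Icc] at hlt ⊢
  constructor
  · intro h
    have hxG : isGrassmannian n k x := by
      refine ⟨hx, fun i hi j hj hij => ?_, fun i hi j hj hij => ?_⟩
      · have := hu.2.1 hi hj hij
        simp only [Finset.coe_Icc, Set.mem_Icc] at hi hj
        exact h i (by omega) j (by omega) hij ((hlt i (by omega) j (by omega)).2 this)
      · have := hu.2.2 hi hj hij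
        simp only [Finset.coe_Icc, Set.mem_Icc] at hi hj
        exact h i (by omega) j (by omega) hij ((hlt i (by omega) j (by omega)).2 this)
    refine ⟨hxG, (hxG.forall_le_iff hkn.le hu).1 fun a b ha hak hkb hbn hab => ?_⟩
    exact h a (by omega) b (by omega) (by omega) ((hlt a (by omega) b (by omega)).2 hab)
  · rintro ⟨hxG, hle⟩ a ha b hb hab hvab
    rw [hlt a ha b hb] at hvab
    by_cases hbk : b ≤ k
    · exact hxG.2.1 (by simp; omega) (by simp; omega) hab
    by_cases hak : k < a
    · exact hxG.2.2 (by simp; omega) (by simp; omega) hab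
    exact (hxG.forall_le_iff hkn.le hu).2 hle a b (by omega) (by omega) (by omega) (by omega) hvab

theorem fixesOutside.image_symm_image_sub {n k : ℕ} (hkn : k ≤ n) {v : Equiv.Perm ℕ}
    (hv : fixesOutside n v) :
    (((Finset.Icc 1 k).image ⇑v.symm).image fun s => n + 1 - s) =
      (Finset.Icc 1 k).image (revPerm n * v⁻¹) := by
  rw [Finset.image_image]
  refine Finset.image_congr fun i hi => ?_
  simp only [Finset.coe_Icc, Set.mem_Icc] at hi
  exact (revPerm_of_mem ((hv.inv.mem_iff i).2 (by simp; omega))).symm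

theorem fixesOutside.image_subset {n k : ℕ} (hkn : k ≤ n) {x : Equiv.Perm ℕ}
    (hx : fixesOutside n x) : (Finset.Icc 1 k).image x ⊆ Finset.Icc 1 n :=
  hx.image_Icc ▸ Finset.image_subset_image (Finset.Icc_subset_Icc_right hkn)

/-- `(v, w) ↦ ((wv⁻¹)({1,…,k}), {n+1−s : s ∈ v⁻¹({1,…,k})})` is a bijection
from the pairs with `v ∈ W^K_max` and `ℓ(w) = ℓ(wv⁻¹) + ℓ(v)` onto the pairs `(J, L)`
of `k`-element subsets of `[n]` with the `r`-th smallest element of `J` at most that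
of `L` for every `1 ≤ r ≤ k`. -/
theorem length_additive_pairs_biject_with_path_pairs (n k : ℕ)
    (hn : 2 ≤ n) (hk1 : 1 < k) (hkn : k < n) :
    Set.BijOn
      (fun vw : Equiv.Perm ℕ × Equiv.Perm ℕ =>
        ((Finset.Icc 1 k).image ⇑(vw.2 * vw.1⁻¹),
         ((Finset.Icc 1 k).image ⇑vw.1.symm).image fun s => n + 1 - s))
      {vw : Equiv.Perm ℕ × Equiv.Perm ℕ |
        isWKmax n k vw.1 ∧ fixesOutside n vw.2 ∧
        invLen n vw.2 = invLen n (vw.2 * vw.1⁻¹) + invLen n vw.1}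
      {JL : Finset ℕ × Finset ℕ |
        JL.1 ⊆ Finset.Icc 1 n ∧ JL.2 ⊆ Finset.Icc 1 n ∧
        JL.1.card = k ∧ JL.2.card = k ∧
        ∀ r, 1 ≤ r → r ≤ k → sortedGet JL.1 r ≤ sortedGet JL.2 r} := by
  have additive_iff : ∀ v w, isWKmax n k v → fixesOutside n w →
      (invLen n w = invLen n (w * v⁻¹) + invLen n v ↔ isGrassmannian n k (w * v⁻¹) ∧
        ∀ a, 1 ≤ a → a ≤ k → (w * v⁻¹) a ≤ (revPerm n * v⁻¹) a) := fun v w hv hw => by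
    simpa using hv.invLen_mul_eq_add_iff hkn (hw.mul hv.1.inv)
  refine ⟨?_, ?_, ?_⟩
  · rintro ⟨v, w⟩ ⟨hv, hw, hadd⟩
    dsimp only at hv hw hadd ⊢
    obtain ⟨hx, hle⟩ := (additive_iff v w hv hw).1 hadd
    have hu := (isWKmax_iff_isGrassmannian hkn v).1 hv
    rw [hv.1.image_symm_image_sub hkn.le]
    refine ⟨hx.1.image_subset hkn.le, hu.1.image_subset hkn.le, ?_, ?_, fun r hr hrk => ?_⟩
    · rw [Finset.card_image_of_injective _ (w * v⁻¹).injective, Nat.card_Icc, Nat.add_sub_cancel]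
    · rw [Finset.card_image_of_injective _ (revPerm n * v⁻¹).injective, Nat.card_Icc,
        Nat.add_sub_cancel]
    · rw [hx.sortedGet_image hr hrk, hu.sortedGet_image hr hrk]
      exact hle r hr hrk
  · rintro ⟨v, w⟩ ⟨hv, hw, hadd⟩ ⟨v', w'⟩ ⟨hv', hw', hadd'⟩ heq
    dsimp only at hv hw hadd hv' hw' hadd' heq
    rw [hv.1.image_symm_image_sub hkn.le, hv'.1.image_symm_image_sub hkn.le,
      Prod.mk.injEq] at heq
    have hu := ((isWKmax_iff_isGrassmannian hkn v).1 hv).eq_of_image_eq hkn.le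
      ((isWKmax_iff_isGrassmannian hkn v').1 hv') heq.2
    have hx := ((additive_iff v w hv hw).1 hadd).1.eq_of_image_eq hkn.le
      ((additive_iff v' w' hv' hw').1 hadd').1 heq.1
    obtain rfl : v = v' := inv_injective (mul_left_cancel hu)
    obtain rfl : w = w' := mul_right_cancel hx
    rfl
  · rintro ⟨J, L⟩ ⟨hJ, hL, hJk, hLk, hle⟩
    dsimp only at hJ hL hJk hLk hle
    obtain ⟨x, hx, hxJ⟩ := exists_isGrassmannian hJ
    obtain ⟨u, hu, huL⟩ := exists_isGrassmannian hL
    rw [hJk] at hx hxJ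
    rw [hLk] at hu huL
    have huv : revPerm n * (u⁻¹ * revPerm n)⁻¹ = u := by
      rw [mul_inv_rev, inv_inv, mul_inv_cancel_left]
    have hv : isWKmax n k (u⁻¹ * revPerm n) := by
      rwa [isWKmax_iff_isGrassmannian hkn, huv]
    have hw : fixesOutside n (x * (u⁻¹ * revPerm n)) := hx.1.mul hv.1
    refine ⟨(u⁻¹ * revPerm n, x * (u⁻¹ * revPerm n)), ⟨hv, hw, ?_⟩, ?_⟩
    · dsimp only
      rw [additive_iff _ _ hv hw, mul_inv_cancel_right, huv]
      refine ⟨hx, fun a ha hak => ?_⟩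
      rw [← hx.sortedGet_image ha hak, ← hu.sortedGet_image ha hak, hxJ, huL]
      exact hle a ha hak
    · dsimp only
      rw [hv.1.image_symm_image_sub hkn.le, huv, mul_inv_cancel_right, hxJ, huL]
end

section
/- Let v ∈ W^K_max and let x ∈ S_n satisfy ℓ(xv) = ℓ(x) + ℓ(v). Then for every r with 1 ≤ r ≤ k, the r-th smallest element of x({1,…,k}) is at most n+1 minus the r-th largest element of v^{-1}({1,…,k}); equivalently, the r-th smallest element of x({1,…,k}) is at most the r-th smallest element of {n+1−s : s ∈ v^{-1}({1,…,k})}. -/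
theorem fixesOutside.apply_mem {n : ℕ} {v : Equiv.Perm ℕ} (hv : fixesOutside n v) {i : ℕ}
    (hi : i ∈ Finset.Icc 1 n) : v i ∈ Finset.Icc 1 n := by
  by_contra h
  exact h ((v.injective (hv _ h)).symm ▸ hi)

theorem fixesOutside.symm {n : ℕ} {v : Equiv.Perm ℕ} (hv : fixesOutside n v) :
    fixesOutside n v.symm := fun i hi => by
  rw [Equiv.symm_apply_eq, hv i hi]

/-- The `r`-th smallest element of `f({1,…,k})` is `f(r)` when `f` is increasing on `{1,…,k}`. -/
theorem sortedGet_image_Icc_s5 {f : ℕ → ℕ} {k r : ℕ} (hf : StrictMonoOn f (Set.Icc 1 k))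
    (hr1 : 1 ≤ r) (hrk : r ≤ k) : sortedGet ((Finset.Icc 1 k).image f) r = f r := by
  have hlt : ((List.range' 1 k).map f).Pairwise (· < ·) := by
    rw [List.pairwise_map]
    refine List.Pairwise.imp_of_mem (fun {a b} ha hb hab => ?_) List.pairwise_lt_range'
    rw [List.mem_range'_1] at ha hb
    exact hf ⟨by omega, by omega⟩ ⟨by omega, by omega⟩ hab
  have himg : (Finset.Icc 1 k).image f = ((List.range' 1 k).map f).toFinset := by
    ext a
    simp only [Finset.mem_image, Finset.mem_Icc, List.mem_toFinset, List.mem_map,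
      List.mem_range'_1]
    grind
  have hsort := (List.toFinset_sort (· ≤ ·) (hlt.imp ne_of_lt)).2 (hlt.imp le_of_lt)
  rw [sortedGet, himg, hsort, List.getD_eq_getElem _ _ (by simp; omega)]
  simp only [List.getElem_map, List.getElem_range']
  congr 1
  omega

/-- If lengths add in the product `x * v`, then `x` does not undo any inversion of `v`. -/
theorem mul_apply_lt_of_invLen_mul {n : ℕ} {x v : Equiv.Perm ℕ} (hv : fixesOutside n v)
    (hadd : invLen n (x * v) = invLen n x + invLen n v) {i j : ℕ} (hi : 1 ≤ i) (hij : i < j)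
    (hj : j ≤ n) (hvij : v j < v i) : x (v j) < x (v i) := by
  let inv (y : Equiv.Perm ℕ) : Finset (ℕ × ℕ) :=
    (Finset.Icc 1 n ×ˢ Finset.Icc 1 n).filter fun p => p.1 < p.2 ∧ y p.2 < y p.1
  have mem_inv (y : Equiv.Perm ℕ) (p : ℕ × ℕ) : p ∈ inv y ↔
      (p.1 ∈ Finset.Icc 1 n ∧ p.2 ∈ Finset.Icc 1 n) ∧ p.1 < p.2 ∧ y p.2 < y p.1 := by
    simp only [inv, Finset.mem_filter, Finset.mem_product]
  have hcard : (inv (x * v)).card = (inv x).card + (inv v).card := hadd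
  let kept := (inv v).filter fun p => x (v p.2) < x (v p.1)
  have hsplit := Finset.card_filter_add_card_filter_not (s := inv (x * v)) (fun p => v p.2 < v p.1)
  have hkept : ((inv (x * v)).filter fun p => v p.2 < v p.1).card ≤ kept.card := by
    refine Finset.card_le_card fun p hp => ?_
    simp only [kept, Finset.mem_filter, mem_inv, Equiv.Perm.mul_apply] at hp ⊢
    tauto
  have hnew : ((inv (x * v)).filter fun p => ¬ v p.2 < v p.1).card ≤ (inv x).card := by
    refine Finset.card_le_card_of_injOn (Prod.map v v) (fun p hp => ?_)
      (v.injective.prodMap v.injective).injOn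
    simp only [Finset.coe_filter, Set.mem_ofPred_eq, mem_inv, Equiv.Perm.mul_apply] at hp
    obtain ⟨⟨⟨h1, h2⟩, hlt, hxv⟩, hle⟩ := hp
    have hne : v p.1 ≠ v p.2 := v.injective.ne hlt.ne
    rw [Finset.mem_coe, mem_inv]
    exact ⟨⟨hv.apply_mem h1, hv.apply_mem h2⟩, lt_of_le_of_ne (not_lt.1 hle) hne, hxv⟩
  have heq : kept = inv v :=
    Finset.eq_of_subset_of_card_le (Finset.filter_subset _ _) (by omega)
  have hmem : (i, j) ∈ kept := by
    rw [heq, mem_inv]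
    simp only [Finset.mem_Icc]
    omega
  exact (Finset.mem_filter.1 hmem).2

/-- if `v ∈ W^K_max` and `ℓ(xv) = ℓ(x) + ℓ(v)`, then for every `1 ≤ r ≤ k`,
the `r`-th smallest element of `x({1,…,k})` is at most the `r`-th smallest element of
`{n+1−s : s ∈ v⁻¹({1,…,k})}`. -/
theorem path_of_x_above_path_of_v (n k : ℕ)
    (hn : 2 ≤ n) (hk1 : 1 < k) (hkn : k < n)
    (v x : Equiv.Perm ℕ) (hv : isWKmax n k v) (hx : fixesOutside n x)
    (hadd : invLen n (x * v) = invLen n x + invLen n v) :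
    ∀ r, 1 ≤ r → r ≤ k →
      sortedGet ((Finset.Icc 1 k).image ⇑x) r ≤
        sortedGet (((Finset.Icc 1 k).image ⇑v.symm).image fun s => n + 1 - s) r := by
  intro r hr1 hrk
  obtain ⟨hfix, hdec, -⟩ := hv
  have hv_mem {i : ℕ} (h1 : 1 ≤ i) (h2 : i ≤ n) : 1 ≤ v.symm i ∧ v.symm i ≤ n :=
    Finset.mem_Icc.1 (hfix.symm.apply_mem (Finset.mem_Icc.2 ⟨h1, h2⟩))
  have hx_lt {a b : ℕ} (ha : 1 ≤ a) (hab : a < b) (hb : b ≤ n) (h : v.symm b < v.symm a) :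
      x a < x b := by
    have := mul_apply_lt_of_invLen_mul hfix hadd (hv_mem (by omega) hb).1 h
      (hv_mem ha (by omega)).2 (by simpa using hab)
    simpa using this
  have hx_mono : StrictMonoOn x (Set.Icc 1 k) := fun a ha b hb hab =>
    hx_lt ha.1 hab (hb.2.trans hkn.le) (hdec a b ha.1 hab hb.2)
  have hv_mono : StrictMonoOn ((fun s => n + 1 - s) ∘ v.symm) (Set.Icc 1 k) :=
    fun a ha b hb hab => by
      have := hdec a b ha.1 hab hb.2
      have := hv_mem ha.1 (ha.2.trans hkn.le)
      simp only [Function.comp_apply]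
      omega
  rw [Finset.image_image, sortedGet_image_Icc_s5 hx_mono hr1 hrk, sortedGet_image_Icc_s5 hv_mono hr1 hrk]
  have hxr := Finset.mem_Icc.1 (hx.apply_mem (Finset.mem_Icc.2 ⟨hr1, hrk.trans hkn.le⟩))
  have hcard : (Finset.Ico 1 (x r)).card ≤ (Finset.Ioc (v.symm r) n).card := by
    refine Finset.card_le_card_of_injOn (fun a => v.symm (x.symm a)) (fun a ha => ?_)
      (v.symm.injective.comp x.symm.injective).injOn
    rw [Finset.coe_Ico, Set.mem_Ico] at ha
    obtain ⟨b, rfl⟩ := x.surjective a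
    have hb : 1 ≤ b ∧ b ≤ n := by
      have := hx.symm.apply_mem (i := x b) (Finset.mem_Icc.2 (by omega))
      simpa using this
    simp only [Equiv.symm_apply_apply, Finset.coe_Ioc, Set.mem_Ioc]
    refine ⟨?_, (hv_mem hb.1 hb.2).2⟩
    have hbr : b ≠ r := by
      rintro rfl
      exact ha.2.false
    rcases hbr.lt_or_gt with h | h
    · exact hdec b r hb.1 h hrk
    · by_contra hle
      have hne : v.symm b ≠ v.symm r := v.symm.injective.ne hbr
      exact ha.2.asymm (hx_lt hr1 h hb.2 (lt_of_le_of_ne (not_lt.1 hle) hne))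
  rw [Nat.card_Ico, Nat.card_Ioc] at hcard
  have := hv_mem hr1 (hrk.trans hkn.le)
  simp only [Function.comp_apply]
  omega
end
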